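/- arXiv:2406.01295 — 2 statements merged into one kernel-verified Lean document; each statement's English description precedes it below -/
import Mathlib

section
/- Let ω = 1 + √2 and for k ∈ ℕ set S k = −(k+2)²·(2k+1)²·(4k+1)·(4k+9), T k = 6(k+2)(2k+3)(4k+7), U k = (4k+5)(4k+7)(4k+9). Define p, q : ℕ → ℝ by p 0 = 1, q 0 = 1, p 1 = 8 + 20ω, q 1 = 8 + 15ω, and for all n ≥ 0, p (n+2) = (T n + ω·U n)·p (n+1) + S n·p n and q (n+2) = (T n + ω·U n)·q (n+1) + S n·q n. Then there exists a constant C > 0 such that for all n ≥ 1, |p n / q n − 4/π| ≤ C·(7 + 4√2 + 2·√(20 + 14√2))^(−2n). -/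
/-- The Euler-type integral `∫₀¹ r²ⁿ (1 - r²)ⁿ⁺¹ / (w + r²)ⁿ⁺² dr`, a Jacobi function of the
second kind with parameters `(-3/2, 0)` at the point `1 + 2 * w`. -/
noncomputable def jacobiIntegral (w : ℝ) (n : ℕ) : ℝ :=
  ∫ r in (0 : ℝ)..1, r ^ (2 * n) * (1 - r ^ 2) ^ (n + 1) / (w + r ^ 2) ^ (n + 2)

section JacobiIntegral

variable {w : ℝ}

theorem continuous_jacobiIntegrand (hw : 0 < w) (n : ℕ) :
    Continuous fun r : ℝ => r ^ (2 * n) * (1 - r ^ 2) ^ (n + 1) / (w + r ^ 2) ^ (n + 2) := by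
  refine Continuous.div (by fun_prop) (by fun_prop) fun r => ?_
  positivity

theorem jacobiIntegral_nonneg (hw : 0 < w) (n : ℕ) : 0 ≤ jacobiIntegral w n := by
  refine intervalIntegral.integral_nonneg zero_le_one fun r hr => ?_
  have h0 : 0 ≤ r := hr.1
  have h1 : 0 ≤ 1 - r ^ 2 := by nlinarith [hr.2]
  positivity

theorem jacobiIntegral_succ_le (hw : 0 < w) {μ : ℝ} (hμ : 0 < μ)
    (hμw : (μ - 1) ^ 2 = 4 * w * μ) (n : ℕ) :
    μ * jacobiIntegral w (n + 1) ≤ jacobiIntegral w n := by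
  unfold jacobiIntegral
  rw [← intervalIntegral.integral_const_mul]
  refine intervalIntegral.integral_mono_on zero_le_one
    (((continuous_jacobiIntegrand hw (n + 1)).const_mul μ).intervalIntegrable _ _)
    ((continuous_jacobiIntegrand hw n).intervalIntegrable _ _) fun r hr => ?_
  have h0 : 0 ≤ r := hr.1
  have h1 : 0 ≤ 1 - r ^ 2 := by nlinarith [hr.2]
  have hW : 0 < w + r ^ 2 := by positivity
  have key : μ * (r ^ 2 * (1 - r ^ 2)) ≤ w + r ^ 2 := by
    refine le_of_mul_le_mul_left ?_ hμ
    nlinarith [sq_nonneg (2 * μ * r ^ 2 - (μ - 1))]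
  have hF : 0 ≤ r ^ (2 * n) * (1 - r ^ 2) ^ (n + 1) / (w + r ^ 2) ^ (n + 3) := by positivity
  calc μ * (r ^ (2 * (n + 1)) * (1 - r ^ 2) ^ (n + 1 + 1) / (w + r ^ 2) ^ (n + 1 + 2))
      = (μ * (r ^ 2 * (1 - r ^ 2))) *
          (r ^ (2 * n) * (1 - r ^ 2) ^ (n + 1) / (w + r ^ 2) ^ (n + 3)) := by ring
    _ ≤ (w + r ^ 2) * (r ^ (2 * n) * (1 - r ^ 2) ^ (n + 1) / (w + r ^ 2) ^ (n + 3)) := by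
        gcongr
    _ = r ^ (2 * n) * (1 - r ^ 2) ^ (n + 1) / (w + r ^ 2) ^ (n + 2) := by
        rw [pow_succ _ (n + 2)]
        field_simp

theorem jacobiIntegral_recurrence (hw : 0 < w) (k : ℕ) :
    ((k : ℝ) + 3) * (2 * k + 3) * (4 * k + 5) * jacobiIntegral w (k + 2) =
      (4 * (k : ℝ) + 7) / 4 * ((4 * k + 5) * (4 * k + 9) * (1 + 2 * w) + 9) *
          jacobiIntegral w (k + 1) -
        (2 * (k : ℝ) + 1) * (k + 2) * (4 * k + 9) * jacobiIntegral w k := by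
  have hderiv : ∀ r : ℝ, HasDerivAt
      (fun r : ℝ => r ^ (2 * k + 1) * (1 - r ^ 2) ^ (k + 2) *
        (((k : ℝ) + 2) * (4 * k + 9) * w
          + (3 * (4 * k + 7) / 2 - (4 * k + 9) * (4 * k + 5) * w / 2) * r ^ 2
          - (k + 3) * (4 * k + 5) * r ^ 4) / (w + r ^ 2) ^ (k + 3))
      (((k : ℝ) + 3) * (2 * k + 3) * (4 * k + 5) *
          (r ^ (2 * (k + 2)) * (1 - r ^ 2) ^ (k + 2 + 1) / (w + r ^ 2) ^ (k + 2 + 2))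
        - (4 * (k : ℝ) + 7) / 4 * ((4 * k + 5) * (4 * k + 9) * (1 + 2 * w) + 9) *
          (r ^ (2 * (k + 1)) * (1 - r ^ 2) ^ (k + 1 + 1) / (w + r ^ 2) ^ (k + 1 + 2))
        + (2 * (k : ℝ) + 1) * (k + 2) * (4 * k + 9) *
          (r ^ (2 * k) * (1 - r ^ 2) ^ (k + 1) / (w + r ^ 2) ^ (k + 2))) r := by
    intro r
    have hW : w + r ^ 2 ≠ 0 := by positivity
    have h1 := hasDerivAt_pow (2 * k + 1) r
    have h2 := ((hasDerivAt_pow 2 r).const_sub 1).pow (k + 2)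
    have h3 := (((hasDerivAt_pow 2 r).const_mul
      (3 * (4 * (k : ℝ) + 7) / 2 - (4 * k + 9) * (4 * k + 5) * w / 2)).const_add
        (((k : ℝ) + 2) * (4 * k + 9) * w)).sub
          ((hasDerivAt_pow 4 r).const_mul (((k : ℝ) + 3) * (4 * k + 5)))
    have h4 := ((hasDerivAt_pow 2 r).const_add w).pow (k + 3)
    refine (((h1.mul h2).mul h3).div h4 (pow_ne_zero _ hW)).congr_deriv ?_
    simp only [Pi.mul_apply, Pi.pow_apply, Pi.sub_apply]
    have e1 : 2 * k + 1 - 1 = 2 * k := by omega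
    have e2 : k + 2 - 1 = k + 1 := by omega
    have e3 : k + 3 - 1 = k + 2 := by omega
    rw [e1, e2, e3]
    push_cast
    generalize hWdef : w + r ^ 2 = W at hW ⊢
    obtain rfl : w = W - r ^ 2 := by linarith
    field_simp
    ring
  have hint : ∀ n : ℕ, IntervalIntegrable
      (fun r : ℝ => r ^ (2 * n) * (1 - r ^ 2) ^ (n + 1) / (w + r ^ 2) ^ (n + 2))
      MeasureTheory.volume 0 1 :=
    fun n => (continuous_jacobiIntegrand hw n).intervalIntegrable _ _
  have hFTC := intervalIntegral.integral_eq_sub_of_hasDerivAt (fun r _ => hderiv r)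
    ((((hint (k + 2)).const_mul _).sub ((hint (k + 1)).const_mul _)).add ((hint k).const_mul _))
  rw [intervalIntegral.integral_add
      (((hint (k + 2)).const_mul _).sub ((hint (k + 1)).const_mul _)) ((hint k).const_mul _),
    intervalIntegral.integral_sub ((hint (k + 2)).const_mul _) ((hint (k + 1)).const_mul _),
    intervalIntegral.integral_const_mul, intervalIntegral.integral_const_mul,
    intervalIntegral.integral_const_mul] at hFTC
  simp only [one_pow, sub_self, ne_eq, Nat.add_eq_zero_iff, OfNat.ofNat_ne_zero, and_false,
    not_false_eq_true, zero_pow, mul_zero, zero_mul, zero_div, one_ne_zero] at hFTC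
  unfold jacobiIntegral
  linarith

end JacobiIntegral

theorem arctan_inv_one_add_sqrt_two : Real.arctan (1 / (1 + √2)) = Real.pi / 8 := by
  have h2 : √2 ^ 2 = 2 := Real.sq_sqrt (by norm_num)
  have h0 : 0 < √2 := by positivity
  have hlt : 1 / (1 + √2) < 1 := by
    rw [div_lt_one (by positivity)]; linarith
  have h := Real.two_mul_arctan (x := 1 / (1 + √2))
    (by have : 0 < 1 / (1 + √2) := by positivity
        linarith) hlt
  have h1 : 2 * (1 / (1 + √2)) / (1 - (1 / (1 + √2)) ^ 2) = 1 := by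
    have : (1 + √2) ^ 2 - 1 ≠ 0 := by nlinarith
    field_simp
    nlinarith
  rw [h1, Real.arctan_one] at h
  linarith

section Initial

variable {ω : ℝ}

theorem hasDerivAt_arctan_div (hω : 0 < ω) (r : ℝ) :
    HasDerivAt (fun r : ℝ => Real.arctan (r / ω)) (ω / (ω ^ 2 + r ^ 2)) r := by
  refine (((hasDerivAt_id r).div_const ω).arctan).congr_deriv ?_
  have : ω ^ 2 + r ^ 2 ≠ 0 := by positivity
  simp only [id]
  field_simp

theorem jacobiIntegral_zero (hω : 0 < ω) :
    jacobiIntegral (ω ^ 2) 0 =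
      1 / (2 * ω ^ 2) + Real.arctan (1 / ω) * ((1 - ω ^ 2) / (2 * ω ^ 3)) := by
  have hderiv : ∀ r : ℝ, HasDerivAt
      (fun r : ℝ => (1 + ω ^ 2) / (2 * ω ^ 2) * (r / (ω ^ 2 + r ^ 2)) +
        Real.arctan (r / ω) * ((1 - ω ^ 2) / (2 * ω ^ 3)))
      (r ^ (2 * 0) * (1 - r ^ 2) ^ (0 + 1) / (ω ^ 2 + r ^ 2) ^ (0 + 2)) r := by
    intro r
    have hW : ω ^ 2 + r ^ 2 ≠ 0 := by positivity
    refine ((((hasDerivAt_id r).div ((hasDerivAt_pow 2 r).const_add (ω ^ 2)) hW).const_mul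
      ((1 + ω ^ 2) / (2 * ω ^ 2))).add
        ((hasDerivAt_arctan_div hω r).mul_const ((1 - ω ^ 2) / (2 * ω ^ 3)))).congr_deriv ?_
    simp only [id]
    field_simp
    ring
  have hW : (ω ^ 2 + 1) ≠ 0 := by positivity
  rw [jacobiIntegral, intervalIntegral.integral_eq_sub_of_hasDerivAt (fun r _ => hderiv r)
    ((continuous_jacobiIntegrand (by positivity) 0).intervalIntegrable _ _)]
  simp only [zero_div, Real.arctan_zero]
  field_simp
  ring

theorem jacobiIntegral_one (hω : 0 < ω) :
    jacobiIntegral (ω ^ 2) 1 =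
      1 + (1 + ω ^ 2 + 2 * ω ^ 2) / (2 * ω ^ 2) - 1 / 4
        - 3 * (1 + ω ^ 2) / (8 * ω ^ 2)
        + Real.arctan (1 / ω) * (-(2 + 3 * ω ^ 2) / ω
          + (1 + ω ^ 2) * (1 + 3 * ω ^ 2) / (2 * ω ^ 3)
          - 3 * (1 + ω ^ 2) ^ 2 / (8 * ω ^ 3)) := by
  have hderiv : ∀ r : ℝ, HasDerivAt
      (fun r : ℝ => r +
        ((1 + ω ^ 2) * (1 + 3 * ω ^ 2) / (2 * ω ^ 2) - 3 * (1 + ω ^ 2) ^ 2 / (8 * ω ^ 2)) *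
          (r / (ω ^ 2 + r ^ 2)) - (1 + ω ^ 2) ^ 2 / 4 * (r / (ω ^ 2 + r ^ 2) ^ 2) +
        Real.arctan (r / ω) * (-(2 + 3 * ω ^ 2) / ω
          + (1 + ω ^ 2) * (1 + 3 * ω ^ 2) / (2 * ω ^ 3)
          - 3 * (1 + ω ^ 2) ^ 2 / (8 * ω ^ 3)))
      (r ^ (2 * 1) * (1 - r ^ 2) ^ (1 + 1) / (ω ^ 2 + r ^ 2) ^ (1 + 2)) r := by
    intro r
    have hW : ω ^ 2 + r ^ 2 ≠ 0 := by positivity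
    have hd := (hasDerivAt_pow 2 r).const_add (ω ^ 2)
    refine ((((hasDerivAt_id r).add (((hasDerivAt_id r).div hd hW).const_mul _)).sub
      (((hasDerivAt_id r).div (hd.pow 2) (pow_ne_zero 2 hW)).const_mul _)).add
        ((hasDerivAt_arctan_div hω r).mul_const _)).congr_deriv ?_
    simp only [id, Pi.pow_apply]
    field_simp
    ring
  have hW : (ω ^ 2 + 1) ≠ 0 := by positivity
  rw [jacobiIntegral, intervalIntegral.integral_eq_sub_of_hasDerivAt (fun r _ => hderiv r)
    ((continuous_jacobiIntegrand (by positivity) 1).intervalIntegrable _ _)]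
  simp only [zero_div, Real.arctan_zero]
  field_simp
  ring

end Initial

section Recurrence

variable {u J : ℕ → ℝ} {x μ : ℝ}

/-- Growth of the dominant solution of the Jacobi recurrence with parameters `(-3/2, 0)`. -/
theorem ratio_le_of_jacobi_recurrence (hμ : 0 < μ) (hx : 2 * x = μ + 1 / μ)
    (hu : ∀ k : ℕ, ((k : ℝ) + 3) * (2 * k + 3) * (4 * k + 5) * u (k + 2) =
      (4 * (k : ℝ) + 7) / 4 * ((4 * k + 5) * (4 * k + 9) * x + 9) * u (k + 1) -
        (2 * (k : ℝ) + 1) * (k + 2) * (4 * k + 9) * u k)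
    (h0 : 0 < u 0) (h1 : μ * u 0 ≤ 2 * u 1) (k : ℕ) :
    0 < u k ∧ μ * (2 * k + 1) * u k ≤ (2 * k + 2) * u (k + 1) := by
  induction k with
  | zero => exact ⟨h0, by simpa using h1⟩
  | succ k ih =>
    obtain ⟨hk, hr⟩ := ih
    have hpos : 0 < u (k + 1) := by
      have : 0 < μ * (2 * k + 1) * u k := by positivity
      exact pos_of_mul_pos_right (this.trans_le hr) (by positivity)
    refine ⟨hpos, ?_⟩
    obtain ⟨m, hm⟩ : ∃ m, m = 1 / μ := ⟨_, rfl⟩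
    have hm0 : 0 < m := by rw [hm]; positivity
    have hmμ : m * μ = 1 := by rw [hm]; field_simp
    have hx' : x = (μ + m) / 2 := by rw [hm]; linarith
    have hr' : (2 * k + 1) * u k ≤ (2 * k + 2) * m * u (k + 1) := by
      have := mul_le_mul_of_nonneg_left hr hm0.le
      calc (2 * k + 1) * u k = m * (μ * (2 * k + 1) * u k) := by
            linear_combination (-(2 * k + 1) * u k) * hmμ
        _ ≤ m * ((2 * k + 2) * u (k + 1)) := this
        _ = _ := by ring
    have hk3 : (0 : ℝ) < (k + 3) * (2 * k + 3) * (4 * k + 5) := by positivity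
    have hr2 : (2 * k + 4) * ((k + 2) * (4 * k + 9)) * ((2 * k + 1) * u k) ≤
        (2 * k + 4) * ((k + 2) * (4 * k + 9)) * ((2 * k + 2) * m * u (k + 1)) := by gcongr
    have hpoly : 0 ≤ u (k + 1) *
        ((2 * k + 4) * ((4 * (k : ℝ) + 7) / 4 * ((4 * k + 5) * (4 * k + 9) * x + 9)
          - (k + 2) * (4 * k + 9) * (2 * k + 2) * m)
          - μ * (2 * k + 3) * ((k + 3) * (2 * k + 3) * (4 * k + 5))) := by
      refine mul_nonneg hpos.le ?_
      rw [hx']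
      ring_nf
      positivity
    have huk := hu k
    push_cast
    refine le_of_mul_le_mul_left ?_ hk3
    have : (k + 3) * (2 * k + 3) * (4 * k + 5) * ((2 * ((k : ℝ) + 1) + 2) * u (k + 1 + 1)) =
        (2 * k + 4) * ((4 * (k : ℝ) + 7) / 4 * ((4 * k + 5) * (4 * k + 9) * x + 9) * u (k + 1) -
        (2 * (k : ℝ) + 1) * (k + 2) * (4 * k + 9) * u k) := by
      rw [← huk]; ring
    rw [this]
    linarith

theorem pow_le_of_ratio_le (hμ : 0 < μ) (h0 : u 0 = 1)
    (h : ∀ k : ℕ, 0 < u k ∧ μ * (2 * k + 1) * u k ≤ (2 * k + 2) * u (k + 1)) (n : ℕ) :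
    μ ^ (2 * n) ≤ (4 * n + 1) * u n ^ 2 := by
  induction n with
  | zero => simp [h0]
  | succ n ih =>
    obtain ⟨hn, hr⟩ := h n
    have hsq : (μ * (2 * n + 1) * u n) ^ 2 ≤ ((2 * n + 2) * u (n + 1)) ^ 2 := by gcongr
    have hc : (0 : ℝ) < (2 * n + 2) ^ 2 := by positivity
    refine le_of_mul_le_mul_left ?_ hc
    calc (2 * (n : ℝ) + 2) ^ 2 * μ ^ (2 * (n + 1))
        = (2 * n + 2) ^ 2 * μ ^ 2 * μ ^ (2 * n) := by ring
      _ ≤ (2 * n + 2) ^ 2 * μ ^ 2 * ((4 * n + 1) * u n ^ 2) := by gcongr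
      _ ≤ (4 * n + 5) * (μ * (2 * n + 1) * u n) ^ 2 := by
          have : 0 ≤ μ ^ 2 * u n ^ 2 := by positivity
          nlinarith
      _ ≤ (4 * n + 5) * ((2 * n + 2) * u (n + 1)) ^ 2 := by gcongr
      _ = _ := by push_cast; ring

theorem casoratian_of_jacobi_recurrence
    (hu : ∀ k : ℕ, ((k : ℝ) + 3) * (2 * k + 3) * (4 * k + 5) * u (k + 2) =
      (4 * (k : ℝ) + 7) / 4 * ((4 * k + 5) * (4 * k + 9) * x + 9) * u (k + 1) -
        (2 * (k : ℝ) + 1) * (k + 2) * (4 * k + 9) * u k)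
    (hJ : ∀ k : ℕ, ((k : ℝ) + 3) * (2 * k + 3) * (4 * k + 5) * J (k + 2) =
      (4 * (k : ℝ) + 7) / 4 * ((4 * k + 5) * (4 * k + 9) * x + 9) * J (k + 1) -
        (2 * (k : ℝ) + 1) * (k + 2) * (4 * k + 9) * J k) (n : ℕ) :
    5 * ((n : ℝ) + 2) * (2 * n + 1) * (J n * u (n + 1) - J (n + 1) * u n) =
      2 * (4 * n + 5) * (J 0 * u 1 - J 1 * u 0) := by
  induction n with
  | zero => push_cast; ring
  | succ n ih =>
    have hc : (4 * (n : ℝ) + 5) ≠ 0 := by positivity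
    refine mul_left_cancel₀ hc ?_
    push_cast
    linear_combination (4 * (n : ℝ) + 9) * ih + 5 * J (n + 1) * hu n - 5 * u (n + 1) * hJ n

/-- The quotient of a recessive and a dominant solution decays like `μ ^ (-2 * n)`. -/
theorem div_le_of_jacobi_recurrence (hμ : 3 ≤ μ) (hx : 2 * x = μ + 1 / μ)
    (hu : ∀ k : ℕ, ((k : ℝ) + 3) * (2 * k + 3) * (4 * k + 5) * u (k + 2) =
      (4 * (k : ℝ) + 7) / 4 * ((4 * k + 5) * (4 * k + 9) * x + 9) * u (k + 1) -
        (2 * (k : ℝ) + 1) * (k + 2) * (4 * k + 9) * u k)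
    (hJ : ∀ k : ℕ, ((k : ℝ) + 3) * (2 * k + 3) * (4 * k + 5) * J (k + 2) =
      (4 * (k : ℝ) + 7) / 4 * ((4 * k + 5) * (4 * k + 9) * x + 9) * J (k + 1) -
        (2 * (k : ℝ) + 1) * (k + 2) * (4 * k + 9) * J k)
    (h0 : u 0 = 1) (h1 : μ ≤ 2 * u 1) (hJ0 : ∀ n, 0 ≤ J n)
    (hJμ : ∀ n, μ * J (n + 1) ≤ J n) (n : ℕ) :
    J n / u n ≤ 8 * (J 0 * u 1 - J 1 * u 0) / μ ^ (2 * n) := by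
  have hμ0 : 0 < μ := by linarith
  have hratio := ratio_le_of_jacobi_recurrence hμ0 hx hu (by rw [h0]; norm_num)
    (by rw [h0]; linarith)
  have hpow := pow_le_of_ratio_le hμ0 h0 hratio n
  have hcas : ∀ n, J n * u n ≤ J n * u (n + 1) - J (n + 1) * u n := by
    intro n
    obtain ⟨hn, hr⟩ := hratio n
    have h2 : 3 / 2 * u n ≤ u (n + 1) := by
      have : (3 * (n + 1)) * u n ≤ (2 * n + 2) * u (n + 1) := by
        refine le_trans ?_ hr
        have : 3 * ((n : ℝ) + 1) ≤ μ * (2 * n + 1) := by nlinarith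
        gcongr
      refine le_of_mul_le_mul_left (a := 2 * (n : ℝ) + 2) ?_ (by positivity)
      linarith
    have h3 : 3 * J (n + 1) ≤ J n := by nlinarith [hJμ n, hJ0 (n + 1)]
    nlinarith [mul_le_mul_of_nonneg_left h2 (hJ0 n), mul_le_mul_of_nonneg_right h3 hn.le,
      mul_nonneg (hJ0 n) hn.le]
  have hD0 : 0 ≤ J 0 * u 1 - J 1 * u 0 :=
    (mul_nonneg (hJ0 0) (hratio 0).1.le).trans (hcas 0)
  have hun := (hratio n).1
  rw [div_le_div_iff₀ hun (by positivity)]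
  have hc := casoratian_of_jacobi_recurrence hu hJ n
  have hk : (0 : ℝ) < 5 * ((n : ℝ) + 2) * (2 * n + 1) := by positivity
  have hbound : (4 * n + 1) * (J n * u n) ≤ 8 * (J 0 * u 1 - J 1 * u 0) := by
    refine le_of_mul_le_mul_left ?_ hk
    calc 5 * ((n : ℝ) + 2) * (2 * n + 1) * ((4 * n + 1) * (J n * u n))
        ≤ 5 * ((n : ℝ) + 2) * (2 * n + 1) *
            ((4 * n + 1) * (J n * u (n + 1) - J (n + 1) * u n)) := by
          gcongr; exact hcas n
      _ = (4 * n + 1) * (2 * (4 * n + 5)) * (J 0 * u 1 - J 1 * u 0) := by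
          linear_combination (4 * (n : ℝ) + 1) * hc
      _ ≤ (5 * ((n : ℝ) + 2) * (2 * n + 1) * 8) * (J 0 * u 1 - J 1 * u 0) := by
          gcongr ?_ * _
          nlinarith [(Nat.cast_nonneg n : (0 : ℝ) ≤ n)]
      _ = _ := by ring
  calc J n * μ ^ (2 * n) ≤ J n * ((4 * n + 1) * u n ^ 2) :=
        mul_le_mul_of_nonneg_left hpow (hJ0 n)
    _ = (4 * n + 1) * (J n * u n) * u n := by ring
    _ ≤ 8 * (J 0 * u 1 - J 1 * u 0) * u n := by gcongr

end Recurrence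

/-- The gauge factor turning the continued fraction recurrence into the Jacobi recurrence. -/
noncomputable def jacobiGauge (n : ℕ) : ℝ :=
  ∏ i ∈ Finset.range n, ((i : ℝ) + 2) * (2 * i + 1) * (4 * i + 1)

theorem jacobiGauge_pos (n : ℕ) : 0 < jacobiGauge n :=
  Finset.prod_pos fun _ _ => by positivity

theorem jacobiGauge_succ (n : ℕ) :
    jacobiGauge (n + 1) = jacobiGauge n * (((n : ℝ) + 2) * (2 * n + 1) * (4 * n + 1)) :=
  Finset.prod_range_succ _ _

theorem div_jacobiGauge_recurrence {y : ℕ → ℝ} {a b : ℝ} {k : ℕ}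
    (hy : y (k + 2) = a * y (k + 1) +
      -((k : ℝ) + 2) ^ 2 * (2 * k + 1) ^ 2 * (4 * k + 1) * (4 * k + 9) * y k) (hab : a = b) :
    ((k : ℝ) + 3) * (2 * k + 3) * (4 * k + 5) * (y (k + 2) / jacobiGauge (k + 2)) =
      b * (y (k + 1) / jacobiGauge (k + 1)) -
        (2 * (k : ℝ) + 1) * (k + 2) * (4 * k + 9) * (y k / jacobiGauge k) := by
  have hg := (jacobiGauge_pos k).ne'
  rw [hy, ← hab, jacobiGauge_succ (k + 1), jacobiGauge_succ k]
  push_cast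
  have h1 : (k : ℝ) + 1 + 2 ≠ 0 := by positivity
  have h2 : 2 * ((k : ℝ) + 1) + 1 ≠ 0 := by positivity
  have h3 : 4 * ((k : ℝ) + 1) + 1 ≠ 0 := by positivity
  field_simp
  ring

/-- Two solutions of a three-term recurrence with the same initial values agree. -/
theorem eq_of_jacobi_recurrence {u v : ℕ → ℝ} {x : ℝ}
    (hu : ∀ k : ℕ, ((k : ℝ) + 3) * (2 * k + 3) * (4 * k + 5) * u (k + 2) =
      (4 * (k : ℝ) + 7) / 4 * ((4 * k + 5) * (4 * k + 9) * x + 9) * u (k + 1) -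
        (2 * (k : ℝ) + 1) * (k + 2) * (4 * k + 9) * u k)
    (hv : ∀ k : ℕ, ((k : ℝ) + 3) * (2 * k + 3) * (4 * k + 5) * v (k + 2) =
      (4 * (k : ℝ) + 7) / 4 * ((4 * k + 5) * (4 * k + 9) * x + 9) * v (k + 1) -
        (2 * (k : ℝ) + 1) * (k + 2) * (4 * k + 9) * v k)
    (h0 : u 0 = v 0) (h1 : u 1 = v 1) (n : ℕ) : u n = v n := by
  induction n using Nat.twoStepInduction with
  | zero => exact h0
  | one => exact h1
  | more k ih0 ih1 =>
    have hc : ((k : ℝ) + 3) * (2 * k + 3) * (4 * k + 5) ≠ 0 := by positivity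
    refine mul_left_cancel₀ hc ?_
    rw [hu k, hv k, ih0, ih1]

theorem pi_accelerated_cf_convergents_rate
    (ω : ℝ) (hω : ω = 1 + Real.sqrt 2)
    (S T U : ℕ → ℝ)
    (hS : ∀ k : ℕ, S k = -((k : ℝ) + 2) ^ 2 * (2 * k + 1) ^ 2 * (4 * k + 1) * (4 * k + 9))
    (hT : ∀ k : ℕ, T k = 6 * ((k : ℝ) + 2) * (2 * k + 3) * (4 * k + 7))
    (hU : ∀ k : ℕ, U k = (4 * (k : ℝ) + 5) * (4 * k + 7) * (4 * k + 9))
    (p q : ℕ → ℝ)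
    (hp0 : p 0 = 1) (hq0 : q 0 = 1)
    (hp1 : p 1 = 8 + 20 * ω) (hq1 : q 1 = 8 + 15 * ω)
    (hp : ∀ n : ℕ, p (n + 2) = (T n + ω * U n) * p (n + 1) + S n * p n)
    (hq : ∀ n : ℕ, q (n + 2) = (T n + ω * U n) * q (n + 1) + S n * q n) :
    ∃ C : ℝ, 0 < C ∧ ∀ n : ℕ, 1 ≤ n →
      |p n / q n - 4 / Real.pi| ≤
        C * (7 + 4 * Real.sqrt 2 + 2 * Real.sqrt (20 + 14 * Real.sqrt 2)) ^ (-(2 * (n : ℤ))) := by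
  have hs2 : √2 ^ 2 = 2 := Real.sq_sqrt (by norm_num)
  have hs0 : 0 < √2 := by positivity
  have hs1 : √2 < 2 := by nlinarith
  have hω0 : 0 < ω := by rw [hω]; positivity
  have hω2 : ω ^ 2 = 2 * ω + 1 := by rw [hω]; linear_combination hs2
  have hN : √(20 + 14 * √2) ^ 2 = 20 + 14 * √2 := Real.sq_sqrt (by positivity)
  have hN0 : 0 ≤ √(20 + 14 * √2) := Real.sqrt_nonneg _
  have hN7 : √(20 + 14 * √2) ≤ 7 := by nlinarith
  obtain ⟨μ, hμ⟩ : ∃ μ, μ = 7 + 4 * √2 + 2 * √(20 + 14 * √2) := ⟨_, rfl⟩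
  rw [← hμ]
  have hμ3 : 3 ≤ μ := by rw [hμ]; linarith
  have hμ0 : 0 < μ := by linarith
  have hμq : μ ^ 2 - (14 + 8 * √2) * μ + 1 = 0 := by
    rw [hμ]; linear_combination 4 * hN - 16 * hs2
  have hx : 2 * (1 + 2 * ω ^ 2) = μ + 1 / μ := by
    field_simp
    rw [hω2, hω]
    linear_combination -hμq
  have hμw : (μ - 1) ^ 2 = 4 * ω ^ 2 * μ := by
    rw [hω2, hω]; linear_combination hμq
  have hw : 0 < ω ^ 2 := by positivity
  have hcoef : ∀ k : ℕ, T k + ω * U k =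
      (4 * (k : ℝ) + 7) / 4 * ((4 * k + 5) * (4 * k + 9) * (1 + 2 * ω ^ 2) + 9) := by
    intro k
    rw [hT, hU, hω2]; ring
  have hatan : Real.arctan (1 / ω) = Real.pi / 8 := by rw [hω, arctan_inv_one_add_sqrt_two]
  have hg0 : jacobiGauge 0 = 1 := by simp [jacobiGauge]
  have hg1 : jacobiGauge 1 = 2 := by norm_num [jacobiGauge]
  have hJrec := jacobiIntegral_recurrence hw
  have hqrec := fun k => div_jacobiGauge_recurrence (y := q) (by rw [hq k, hS k]) (hcoef k)
  have hL : ∀ n, (4 * q n - Real.pi * p n) / jacobiGauge n =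
      8 * ω ^ 2 * jacobiIntegral (ω ^ 2) n := by
    refine eq_of_jacobi_recurrence (x := 1 + 2 * ω ^ 2) (fun k => ?_) (fun k => ?_) ?_ ?_
    · refine div_jacobiGauge_recurrence (y := fun n => 4 * q n - Real.pi * p n) ?_ (hcoef k)
      simp only [hq k, hp k, hS k]
      ring
    · linear_combination 8 * ω ^ 2 * hJrec k
    · rw [jacobiIntegral_zero hω0, hatan, hp0, hq0, hg0]
      field_simp
      linear_combination Real.pi * hω2
    · rw [jacobiIntegral_one hω0, hatan, hp1, hq1, hg1]
      field_simp
      linear_combination (-960 * ω + Real.pi * (120 * ω ^ 2 + 240 * ω + 8)) * hω2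
  set D := jacobiIntegral (ω ^ 2) 0 * (q 1 / jacobiGauge 1) -
    jacobiIntegral (ω ^ 2) 1 * (q 0 / jacobiGauge 0) with hD
  have hmain := div_le_of_jacobi_recurrence (u := fun n => q n / jacobiGauge n)
    (J := jacobiIntegral (ω ^ 2)) hμ3 hx hqrec hJrec (by simp [hq0, hg0])
    (by
      simp only [hq1, hg1]
      rw [hμ, hω]
      linarith)
    (jacobiIntegral_nonneg hw) (jacobiIntegral_succ_le hw hμ0 hμw)
  have hqpos := fun n => (ratio_le_of_jacobi_recurrence
    (u := fun n => q n / jacobiGauge n) hμ0 hx hqrec (by simp [hq0, hg0])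
    (by
      simp only [hq0, hq1, hg0, hg1]
      rw [hμ, hω]
      linarith) n).1
  refine ⟨8 * ω ^ 2 / Real.pi * (8 * |D|) + 1, by positivity, fun n _ => ?_⟩
  have hπ := Real.pi_pos
  have hgn := jacobiGauge_pos n
  have hqn : 0 < q n := by
    have := mul_pos (hqpos n) hgn
    rwa [div_mul_cancel₀ _ hgn.ne'] at this
  have herr : p n / q n - 4 / Real.pi =
      -(8 * ω ^ 2 / Real.pi * (jacobiIntegral (ω ^ 2) n / (q n / jacobiGauge n))) := by
    have := hL n
    field_simp at this ⊢
    linarith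
  have hpw : μ ^ (-(2 * (n : ℤ))) = 1 / μ ^ (2 * n) := by
    rw [zpow_neg, one_div]
    norm_cast
  have hJu : 0 ≤ jacobiIntegral (ω ^ 2) n / (q n / jacobiGauge n) :=
    div_nonneg (jacobiIntegral_nonneg hw n) (hqpos n).le
  rw [herr, abs_neg, abs_of_nonneg (by positivity), hpw]
  calc 8 * ω ^ 2 / Real.pi * (jacobiIntegral (ω ^ 2) n / (q n / jacobiGauge n))
      ≤ 8 * ω ^ 2 / Real.pi * (8 * D / μ ^ (2 * n)) :=
        mul_le_mul_of_nonneg_left (hmain n) (by positivity)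
    _ ≤ 8 * ω ^ 2 / Real.pi * (8 * |D| / μ ^ (2 * n)) := by
        gcongr
        exact le_abs_self D
    _ = 8 * ω ^ 2 / Real.pi * (8 * |D|) * (1 / μ ^ (2 * n)) := by ring
    _ ≤ (8 * ω ^ 2 / Real.pi * (8 * |D|) + 1) * (1 / μ ^ (2 * n)) := by
        gcongr
        linarith
end

section
/- Let η' = 11 + 8√2 and for k ∈ ℕ set S' k = −16·(k+1)²·(2k+1)²·(4k−1)·(4k+7), T' k = −(4k+5), U' k = 3(4k+3)(4k+5)(4k+7). Define p, q : ℕ → ℝ by p 0 = 0, q 0 = 1, p 1 = 6 + 6η', q 1 = 1 + 9η', p 2 = (T' 0 + η'·U' 0)·p 1 − S' 0·p 0, q 2 = (T' 0 + η'·U' 0)·q 1 − S' 0·q 0, and for all n ≥ 1, p (n+2) = (T' n + η'·U' n)·p (n+1) + S' n·p n and q (n+2) = (T' n + η'·U' n)·q (n+1) + S' n·q n. Then the sequence p n / q n converges to ln 2. -/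
open Filter Topology MeasureTheory intervalIntegral

/-- The values at `x` of the Legendre polynomials. -/
noncomputable def legendreP (x : ℝ) : ℕ → ℝ
  | 0 => 1
  | 1 => x
  | n + 2 => ((2 * n + 3) * x * legendreP x (n + 1) - (n + 1) * legendreP x n) / (n + 2)

/-- The integrand of the Schläfli-type representation of the Legendre function of the second
kind. -/
noncomputable def legendreQKernel (x : ℝ) (n : ℕ) (t : ℝ) : ℝ :=
  (1 - t ^ 2) ^ n / (2 * (x - t)) ^ (n + 1)

/-- The Legendre functions of the second kind, for `1 < x`. -/
noncomputable def legendreQ (x : ℝ) (n : ℕ) : ℝ :=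
  ∫ t in (-1 : ℝ)..1, legendreQKernel x n t

/-- The three-term recurrence satisfied by the Legendre functions of both kinds. -/
def LegendreRec (x : ℝ) (f : ℕ → ℝ) : Prop :=
  ∀ n : ℕ, (n + 2) * f (n + 2) = (2 * n + 3) * x * f (n + 1) - (n + 1) * f n

lemma legendreRec_legendreP (x : ℝ) : LegendreRec x (legendreP x) := by
  intro n
  rw [legendreP]
  field_simp

lemma two_pow_le_legendreP {x : ℝ} (hx : 5 / 2 ≤ x) (n : ℕ) : 2 ^ n ≤ legendreP x n := by
  have key : ∀ n, 0 < legendreP x n ∧ 2 * legendreP x n ≤ legendreP x (n + 1) := by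
    intro n
    induction n with
    | zero => simp only [legendreP]; constructor <;> linarith
    | succ n ih =>
      obtain ⟨h0, h1⟩ := ih
      refine ⟨by linarith, ?_⟩
      have h2 := legendreRec_legendreP x n
      have hn : (0 : ℝ) ≤ n := n.cast_nonneg
      have h3 : 0 < legendreP x (n + 1) := by linarith
      have h4 : (2 * n + 3) * (5 / 2) * legendreP x (n + 1)
          ≤ (2 * n + 3) * x * legendreP x (n + 1) := by gcongr
      have h5 : (n + 1) * (2 * legendreP x n) ≤ (n + 1) * legendreP x (n + 1) := by gcongr
      have h6 : 0 ≤ n * legendreP x (n + 1) := by positivity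
      have h7 : (n + 2) * (2 * legendreP x (n + 1)) ≤ (n + 2) * legendreP x (n + 2) := by
        linarith
      exact le_of_mul_le_mul_left h7 (by positivity)
  induction n with
  | zero => simp [legendreP]
  | succ n ih => rw [pow_succ]; linarith [(key n).2]

lemma sub_pos_of_mem_uIcc {x t : ℝ} (hx : 1 < x) (ht : t ∈ Set.uIcc (-1 : ℝ) 1) : 0 < x - t := by
  rw [Set.uIcc_of_le (by norm_num)] at ht
  linarith [ht.2]

lemma intervalIntegrable_legendreQKernel {x : ℝ} (hx : 1 < x) (n : ℕ) :
    IntervalIntegrable (legendreQKernel x n) volume (-1) 1 := by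
  apply ContinuousOn.intervalIntegrable
  unfold legendreQKernel
  refine ContinuousOn.div (by fun_prop) (by fun_prop) fun t ht => ?_
  have := sub_pos_of_mem_uIcc hx ht
  positivity

lemma legendreQ_zero {x : ℝ} (hx : 1 < x) :
    legendreQ x 0 = (Real.log (x + 1) - Real.log (x - 1)) / 2 := by
  have hd : ∀ t ∈ Set.uIcc (-1 : ℝ) 1,
      HasDerivAt (fun t => -Real.log (x - t) / 2) (legendreQKernel x 0 t) t := by
    intro t ht
    have h := sub_pos_of_mem_uIcc hx ht
    refine (((hasDerivAt_id' t).const_sub x).log h.ne').neg.div_const 2 |>.congr_deriv ?_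
    simp only [legendreQKernel]
    field_simp
    ring
  rw [legendreQ, integral_eq_sub_of_hasDerivAt hd (intervalIntegrable_legendreQKernel hx 0)]
  rw [show x - -1 = x + 1 by ring]
  ring

lemma legendreQ_one {x : ℝ} (hx : 1 < x) : legendreQ x 1 = x * legendreQ x 0 - 1 := by
  have hd : ∀ t ∈ Set.uIcc (-1 : ℝ) 1,
      HasDerivAt (fun t => (t ^ 2 - 2 * x * t + 1) / (4 * (x - t)))
        (legendreQKernel x 1 t - x * legendreQKernel x 0 t) t := by
    intro t ht
    have h := sub_pos_of_mem_uIcc hx ht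
    have h1 : HasDerivAt (fun t : ℝ => t ^ 2 - 2 * x * t + 1) (2 * t - 2 * x) t := by
      refine ((hasDerivAt_pow 2 t).sub ((hasDerivAt_id' t).const_mul (2 * x))).add_const 1
        |>.congr_deriv ?_
      simp
    have h2 : HasDerivAt (fun t : ℝ => 4 * (x - t)) (-4) t :=
      ((hasDerivAt_id' t).const_sub x).const_mul 4 |>.congr_deriv (by norm_num)
    refine (h1.div h2 (by positivity)).congr_deriv ?_
    simp only [legendreQKernel]
    field_simp
    ring
  have hi := intervalIntegrable_legendreQKernel hx
  have := integral_eq_sub_of_hasDerivAt hd ((hi 1).sub ((hi 0).const_mul x))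
  rw [integral_sub (hi 1) ((hi 0).const_mul x), intervalIntegral.integral_const_mul] at this
  change legendreQ x 1 - x * legendreQ x 0 = _ at this
  have e : (1 ^ 2 - 2 * x * 1 + 1) / (4 * (x - 1))
      - ((-1) ^ 2 - 2 * x * (-1) + 1) / (4 * (x - -1)) = -1 := by
    have : x - 1 ≠ 0 := by linarith
    have : x - -1 ≠ 0 := by linarith
    field_simp
    ring
  linarith

lemma legendreRec_legendreQ {x : ℝ} (hx : 1 < x) : LegendreRec x (legendreQ x) := by
  intro n
  have hd : ∀ t ∈ Set.uIcc (-1 : ℝ) 1,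
      HasDerivAt (fun t => (1 - t ^ 2) ^ (n + 1) * (t ^ 2 - 2 * x * t + 1)
          / (2 * (2 * (x - t)) ^ (n + 2)))
        ((n + 2) * legendreQKernel x (n + 2) t - (2 * n + 3) * x * legendreQKernel x (n + 1) t
          + (n + 1) * legendreQKernel x n t) t := by
    intro t ht
    have h := sub_pos_of_mem_uIcc hx ht
    have h1 : HasDerivAt (fun t : ℝ => t ^ 2 - 2 * x * t + 1) (2 * t - 2 * x) t := by
      refine ((hasDerivAt_pow 2 t).sub ((hasDerivAt_id' t).const_mul (2 * x))).add_const 1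
        |>.congr_deriv ?_
      simp
    have h2 : HasDerivAt (fun t : ℝ => 2 * (x - t)) (-2) t :=
      ((hasDerivAt_id' t).const_sub x).const_mul 2 |>.congr_deriv (by norm_num)
    have h3 : HasDerivAt (fun t : ℝ => 1 - t ^ 2) (-(2 * t)) t :=
      (hasDerivAt_pow 2 t).const_sub 1 |>.congr_deriv (by simp)
    have h5 : 2 * (2 * (x - t)) ^ (n + 2) ≠ 0 := by positivity
    refine (((h3.pow (n + 1)).mul h1).div ((h2.pow (n + 2)).const_mul 2) h5).congr_deriv ?_
    simp only [legendreQKernel, Pi.mul_apply, Pi.pow_apply, Nat.add_sub_cancel,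
      show n + 2 - 1 = n + 1 by omega]
    push_cast
    have h4 : 0 < 2 * (x - t) := by positivity
    obtain ⟨y, hy⟩ : ∃ y, y = 2 * (x - t) := ⟨_, rfl⟩
    obtain rfl : x = y / 2 + t := by linarith
    rw [← hy] at h4 ⊢
    simp only [pow_succ]
    field_simp
    ring
  have hi := intervalIntegrable_legendreQKernel hx
  have i2 := (hi (n + 2)).const_mul (n + 2 : ℝ)
  have i1 := (hi (n + 1)).const_mul ((2 * n + 3) * x)
  have i0 := (hi n).const_mul (n + 1 : ℝ)
  have := integral_eq_sub_of_hasDerivAt hd ((i2.sub i1).add i0)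
  rw [integral_add (i2.sub i1) i0, integral_sub i2 i1] at this
  simp only [intervalIntegral.integral_const_mul] at this
  norm_num at this
  simp only [legendreQ]
  linarith

lemma abs_legendreQ_le_one {x : ℝ} (hx : 2 ≤ x) (n : ℕ) : |legendreQ x n| ≤ 1 := by
  have := norm_integral_le_of_norm_le_const (a := -1) (b := 1) (C := 1 / 2)
    (f := legendreQKernel x n) (fun t ht => ?_)
  · norm_num at this
    exact this
  · rw [Set.uIoc_of_le (by norm_num)] at ht
    obtain ⟨ht1, ht2⟩ := ht
    have h0 : 0 ≤ 1 - t ^ 2 := by nlinarith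
    have h2 : 2 ≤ 2 * (x - t) := by linarith
    rw [legendreQKernel, Real.norm_of_nonneg (by positivity), div_le_iff₀ (by positivity)]
    have h3 : (1 - t ^ 2) ^ n ≤ 1 := pow_le_one₀ h0 (by nlinarith)
    have h4 : (2 * (x - t)) ^ (n + 1) ≥ 2 := by
      rw [pow_succ]
      have := one_le_pow₀ (n := n) (show 1 ≤ 2 * (x - t) by linarith)
      nlinarith
    linarith

lemma LegendreRec.two_step {x : ℝ} {f : ℕ → ℝ} (hf : LegendreRec x f) (n : ℕ) :
    2 * (n + 3) * (n + 4) * (2 * n + 3) * f (n + 4)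
      = ((2 * n + 3) * (2 * n + 5) * (2 * n + 7) * (2 * x ^ 2 - 1) - (2 * n + 5)) * f (n + 2)
        - 2 * (n + 2) * (n + 1) * (2 * n + 7) * f n := by
  have h0 := hf n
  have h1 := hf (n + 1)
  have h2 := hf (n + 2)
  push_cast at h1 h2
  rw [show n + 1 + 2 = n + 3 from rfl, show n + 1 + 1 = n + 2 from rfl] at h1
  rw [show n + 2 + 2 = n + 4 from rfl, show n + 2 + 1 = n + 3 from rfl] at h2
  linear_combination 2 * (n + 3) * (2 * n + 3) * h2 + 2 * (2 * n + 7) * (2 * n + 3) * x * h1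
    + 2 * (n + 2) * (2 * n + 7) * h0

/-- The factors normalizing the even Legendre functions to the convergents. -/
noncomputable def cfScale : ℕ → ℝ
  | 0 => 1
  | n + 1 => 2 * (2 * n + 1) * (2 * n + 2) * |4 * (n : ℝ) - 1| * cfScale n

lemma cfScale_pos (n : ℕ) : 0 < cfScale n := by
  induction n with
  | zero => simp [cfScale]
  | succ n ih =>
    have : 4 * (n : ℝ) - 1 ≠ 0 := by
      intro h
      have : (4 * n : ℤ) = 1 := by exact_mod_cast sub_eq_zero.mp h
      omega
    rw [cfScale]
    positivity

lemma cfScale_succ {n : ℕ} (hn : 1 ≤ n) :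
    cfScale (n + 1) = 2 * (2 * n + 1) * (2 * n + 2) * (4 * n - 1) * cfScale n := by
  have : (1 : ℝ) ≤ n := by exact_mod_cast hn
  rw [cfScale, abs_of_pos (by linarith)]

lemma eq_cfScale_mul {x : ℝ} {f u : ℕ → ℝ} (hf : LegendreRec x f) (h0 : u 0 = f 0)
    (h1 : u 1 = 4 * f 2)
    (h2 : u 2 = (-5 + (2 * x ^ 2 - 1) * 105) * u 1 - 112 * u 0)
    (hu : ∀ k : ℕ, 1 ≤ k → u (k + 2) =
      (-(4 * (k : ℝ) + 5) + (2 * x ^ 2 - 1) * ((4 * k + 3) * (4 * k + 5) * (4 * k + 7))) * u (k + 1)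
      + -16 * ((k : ℝ) + 1) ^ 2 * (2 * k + 1) ^ 2 * (4 * k - 1) * (4 * k + 7) * u k) (n : ℕ) :
    u n = cfScale n * f (2 * n) := by
  have c1 : cfScale 1 = 4 := by norm_num [cfScale]
  suffices h : ∀ n, u n = cfScale n * f (2 * n) ∧ u (n + 1) = cfScale (n + 1) * f (2 * (n + 1)) from
    (h n).1
  intro n
  induction n with
  | zero => exact ⟨by simp [h0, cfScale], by simp [h1, c1]⟩
  | succ n ih =>
    refine ⟨ih.2, ?_⟩
    obtain ⟨ih0, ih1⟩ := ih
    have key := hf.two_step (2 * n)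
    have c2 := cfScale_succ (n := n + 1) (by omega)
    rw [show 2 * (n + 1 + 1) = 2 * n + 4 by ring, c2]
    rw [show 2 * (n + 1) = 2 * n + 2 by ring] at ih1
    push_cast at key ⊢
    rcases Nat.eq_zero_or_pos n with rfl | hn
    · norm_num at key ih0 ih1 ⊢
      rw [h2, ih1, h0, c1]
      linear_combination -4 * key
    · rw [hu n hn, ih1, ih0, cfScale_succ hn]
      linear_combination -(2 * (2 * n + 1) * (2 * n + 2) * (4 * n - 1) * cfScale n) * key


theorem log_two_simplified_cf_convergents_tendsto
    (η' : ℝ) (hη' : η' = 11 + 8 * Real.sqrt 2)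
    (S' T' U' : ℕ → ℝ)
    (hS' : ∀ k : ℕ, S' k = -16 * ((k : ℝ) + 1) ^ 2 * (2 * k + 1) ^ 2 * (4 * k - 1) * (4 * k + 7))
    (hT' : ∀ k : ℕ, T' k = -(4 * (k : ℝ) + 5))
    (hU' : ∀ k : ℕ, U' k = 3 * (4 * (k : ℝ) + 3) * (4 * k + 5) * (4 * k + 7))
    (p q : ℕ → ℝ)
    (hp0 : p 0 = 0) (hq0 : q 0 = 1)
    (hp1 : p 1 = 6 + 6 * η') (hq1 : q 1 = 1 + 9 * η')
    (hp2 : p 2 = (T' 0 + η' * U' 0) * p 1 - S' 0 * p 0)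
    (hq2 : q 2 = (T' 0 + η' * U' 0) * q 1 - S' 0 * q 0)
    (hp : ∀ n : ℕ, 1 ≤ n → p (n + 2) = (T' n + η' * U' n) * p (n + 1) + S' n * p n)
    (hq : ∀ n : ℕ, 1 ≤ n → q (n + 2) = (T' n + η' * U' n) * q (n + 1) + S' n * q n) :
    Filter.Tendsto (fun n => p n / q n) Filter.atTop (nhds (Real.log 2)) := by
  obtain ⟨x, hx⟩ : ∃ x : ℝ, x = 3 + 2 * Real.sqrt 2 := ⟨_, rfl⟩
  have hs : Real.sqrt 2 ^ 2 = 2 := Real.sq_sqrt (by norm_num)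
  have hs0 : 0 ≤ Real.sqrt 2 := Real.sqrt_nonneg 2
  have hx2 : 3 * η' = 2 * x ^ 2 - 1 := by
    rw [hη', hx]
    linear_combination -8 * hs
  have hηx : η' = 4 * x - 1 := by rw [hη', hx]; ring
  have hx3 : 3 ≤ x := by linarith
  have hx1 : 1 < x := by linarith
  have hlog : Real.log (x + 1) - Real.log (x - 1) = Real.log 2 / 2 := by
    rw [← Real.log_sqrt (by norm_num), sub_eq_iff_eq_add,
      ← Real.log_mul (by positivity) (by linarith), hx]
    congr 1
    linear_combination -2 * hs
  have hQ := legendreRec_legendreQ hx1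
  have hQ0 : 4 * legendreQ x 0 = Real.log 2 := by rw [legendreQ_zero hx1, hlog]; ring
  have hq' : ∀ n, q n = cfScale n * legendreP x (2 * n) := by
    refine eq_cfScale_mul (legendreRec_legendreP x) (by simp [hq0, legendreP]) ?_ ?_ ?_
    · norm_num [legendreP]
      linear_combination hq1 + 3 * hx2
    · rw [hq2, hT', hU', hS', ← hx2]
      push_cast
      ring
    · intro k hk
      rw [hq k hk, hT', hU', hS', ← hx2]
      ring
  have hE : ∀ n, q n * Real.log 2 - p n = cfScale n * (4 * legendreQ x (2 * n)) := by
    refine eq_cfScale_mul (x := x) (f := fun n => 4 * legendreQ x n) ?_ ?_ ?_ ?_ ?_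
    · intro n
      linear_combination 4 * hQ n
    · simp [hq0, hp0, hQ0]
    · have h2 := hQ 0
      norm_num [legendreQ_one hx1] at h2
      rw [hq1, hp1]
      linear_combination -8 * h2 + 3 * Real.log 2 * hx2 - 6 * hηx - (6 * x ^ 2 - 2) * hQ0
    · rw [hq2, hp2, hT', hU', hS', ← hx2]
      push_cast
      ring
    · intro k hk
      rw [hq k hk, hp k hk, hT', hU', hS', ← hx2]
      ring
  have hP : ∀ n, (2 : ℝ) ^ n ≤ legendreP x (2 * n) := fun n =>
    (pow_le_pow_right₀ (by norm_num) (by omega)).trans (two_pow_le_legendreP (by linarith) (2 * n))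
  rw [tendsto_iff_norm_sub_tendsto_zero]
  have hgeo : Tendsto (fun n : ℕ => 4 * (1 / 2 : ℝ) ^ n) atTop (𝓝 0) := by
    simpa using (tendsto_pow_atTop_nhds_zero_of_lt_one (r := (1 / 2 : ℝ))
      (by norm_num) (by norm_num)).const_mul 4
  refine squeeze_zero (fun _ => norm_nonneg _) (fun n => ?_) hgeo
  have hc := cfScale_pos n
  have hPpos : 0 < legendreP x (2 * n) := (by positivity : (0 : ℝ) < 2 ^ n).trans_le (hP n)
  have e : p n / q n - Real.log 2 = -(4 * legendreQ x (2 * n)) / legendreP x (2 * n) := by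
    have h1 := hE n
    rw [hq' n] at h1 ⊢
    field_simp
    linear_combination -h1
  rw [e, Real.norm_eq_abs, abs_div, abs_neg, abs_mul, abs_of_pos hPpos, abs_of_pos four_pos,
    one_div, inv_pow, ← div_eq_mul_inv]
  have hQle := abs_legendreQ_le_one (x := x) (by linarith) (2 * n)
  exact div_le_div₀ (by norm_num) (by linarith) (by positivity) (hP n)
end
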